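/- Let F be an algebraically closed field of characteristic 0 and let g be a finite-dimensional simple Lie algebra over F with dim g = 248 (type E8), equipped with a grading by (ℤ/2ℤ)^5 such that dim g_α = 8 for every nonzero α ∈ (ℤ/2ℤ)^5. Then for every nonzero α ∈ (ℤ/2ℤ)^5, the homogeneous component g_α is a Cartan subalgebra of g. -/

import Mathlib

open Module

/-- A grading of the Lie algebra `L` over `F` by the additive group `A`:
a direct sum decomposition into subspaces compatible with the bracket. -/
def IsLieGrading (F : Type*) {A L : Type*} [Field F] [AddCommGroup A] [DecidableEq A]
    [LieRing L] [LieAlgebra F L] (gr : A → Submodule F L) : Prop :=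
  DirectSum.IsInternal gr ∧
    ∀ a b : A, ∀ x ∈ gr a, ∀ y ∈ gr b, ⁅x, y⁆ ∈ gr (a + b)

namespace RootPairing

variable {ι K M N : Type*} [Field K] [AddCommGroup M] [Module K M]
  [AddCommGroup N] [Module K N] (P : RootPairing ι K M N)

/-- The permutation of the indices induced by minus the reflection in the root `i`. -/
def negReflection (i k : ι) : ι :=
  P.reflectionPerm (P.reflectionPerm i k) (P.reflectionPerm i k)

lemma root_negReflection (i k : ι) :
    P.root (P.negReflection i k) = P.pairing k i • P.root i - P.root k := by
  rw [negReflection, root_reflectionPerm, reflection_apply_self, root_reflectionPerm,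
    reflection_apply_root, neg_sub]

lemma negReflection_negReflection (i k : ι) : P.negReflection i (P.negReflection i k) = k := by
  apply P.root.injective
  have h : P.pairing (P.negReflection i k) i = P.pairing k i := by
    rw [← root_coroot'_eq_pairing, root_negReflection]
    simp [mul_two]
  simp [root_negReflection, h]

lemma negReflection_ne [CharZero K] [P.IsReduced] {i k : ι} (h : k ≠ i)
    (h' : P.root k ≠ -P.root i) :
    P.negReflection i k ≠ k := by
  intro hk
  have hli := IsReduced.linearIndependent P h h'
  have h2 := congrArg P.root hk
  rw [root_negReflection, sub_eq_iff_eq_add, ← two_smul K] at h2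
  have := (LinearIndependent.pair_iff.mp hli 2 (-P.pairing k i) (by rw [← h2]; simp)).1
  exact two_ne_zero this

lemma pairingIn_negReflection [CharZero K] [P.IsCrystallographic] (i k : ι) :
    P.pairingIn ℤ (P.negReflection i k) i = P.pairingIn ℤ k i := by
  simp [negReflection, ← pairingIn_reflectionPerm]

lemma coxeterWeightIn_negReflection [CharZero K] [P.IsCrystallographic] (i k : ι) :
    P.coxeterWeightIn ℤ (P.negReflection i k) i = P.coxeterWeightIn ℤ k i := by
  rw [coxeterWeightIn, coxeterWeightIn, pairingIn_negReflection]
  simp [negReflection, pairingIn_reflectionPerm]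

variable [Fintype ι]

lemma sum_coxeterWeight_mul_finrank [IsAlgClosed K] [FiniteDimensional K M] [P.IsIrreducible]
    (i : ι) : (∑ k, P.coxeterWeight k i) * finrank K M = 4 * Fintype.card ι := by
  have := IsIrreducible.nontrivial P
  let f : Module.End K M := ∑ k, (P.coroot' k).smulRight (P.root k)
  have hf (x : M) : f x = ∑ k, P.coroot' k x • P.root k := by simp [f]
  obtain ⟨μ, hμ⟩ := Module.End.exists_eigenvalue f
  have htop : f.eigenspace μ = ⊤ := by
    refine IsIrreducible.eq_top_of_invtSubmodule_reflection (P := P) _ (fun j x hx ↦ ?_) hμ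
    rw [Submodule.mem_comap, Module.End.mem_eigenspace_iff]
    rw [Module.End.mem_eigenspace_iff] at hx
    rw [LinearEquiv.coe_coe, ← map_smul, ← hx, hf, hf, map_sum]
    refine Fintype.sum_equiv (P.reflectionPerm j) _ _ fun k ↦ ?_
    rw [coroot'_reflection, map_smul, root_reflectionPerm, reflection_same]
  have hfμ : f = μ • LinearMap.id := by
    ext x
    simpa using Module.End.mem_eigenspace_iff.mp (htop ▸ Submodule.mem_top (x := x))
  have htrace : μ * finrank K M = 2 * Fintype.card ι := by
    have h1 : LinearMap.trace K M f = μ * finrank K M := by simp [hfμ]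
    have h2 : LinearMap.trace K M f = 2 * Fintype.card ι := by
      simp [f, LinearMap.trace_smulRight, mul_comm]
    rw [← h1, h2]
  have hsum : ∑ k, P.coxeterWeight k i = 2 * μ := by
    have h1 : P.coroot' i (f (P.root i)) = 2 * μ := by simp [hfμ, mul_comm]
    rw [← h1, hf, map_sum]
    refine Finset.sum_congr rfl fun k _ ↦ ?_
    rw [map_smul, root_coroot'_eq_pairing, root_coroot'_eq_pairing, smul_eq_mul, coxeterWeight,
      mul_comm]
  rw [hsum, mul_assoc, htrace]
  ring

open Classical in
/-- The indices, other than `i`, of the roots making an acute angle with the root `i`. -/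
noncomputable def acute [P.IsCrystallographic] (i : ι) : Finset ι :=
  {k | 0 < P.pairingIn ℤ k i ∧ k ≠ i}

variable {P} in
lemma mem_acute [P.IsCrystallographic] {i k : ι} :
    k ∈ P.acute i ↔ 0 < P.pairingIn ℤ k i ∧ k ≠ i := by
  simp [acute]

variable [CharZero K] [P.IsCrystallographic]

lemma mem_acute_comm {i k : ι} : k ∈ P.acute i ↔ i ∈ P.acute k := by
  rw [mem_acute, mem_acute, P.zero_lt_pairingIn_iff', ne_comm]

lemma sum_coxeterWeightIn (i : ι) :
    ∑ k, P.coxeterWeightIn ℤ k i = 8 + 2 * ∑ k ∈ P.acute i, P.coxeterWeightIn ℤ k i := by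
  classical
  have hneg : ∑ k with P.pairingIn ℤ k i < 0, P.coxeterWeightIn ℤ k i =
      ∑ k with 0 < P.pairingIn ℤ k i, P.coxeterWeightIn ℤ k i := by
    have hinv (k : ι) : P.reflectionPerm (P.reflectionPerm k k) (P.reflectionPerm k k) = k :=
      P.root.injective (by rw [root_reflectionPerm, reflection_apply_self, root_reflectionPerm,
        reflection_apply_self, neg_neg])
    refine Finset.sum_bij' (fun k _ ↦ P.reflectionPerm k k) (fun k _ ↦ P.reflectionPerm k k)
      ?_ ?_ ?_ ?_ ?_ <;> simp [coxeterWeightIn, hinv]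
  have hpos : ∑ k with 0 < P.pairingIn ℤ k i, P.coxeterWeightIn ℤ k i =
      4 + ∑ k ∈ P.acute i, P.coxeterWeightIn ℤ k i := by
    rw [← Finset.add_sum_erase _ _ (a := i) (by simp)]
    congr 1
    · simp [coxeterWeightIn]
    · congr 1
      ext k
      simp [mem_acute, and_comm]
  have h0 : ∑ k with P.pairingIn ℤ k i = 0, P.coxeterWeightIn ℤ k i = 0 :=
    Finset.sum_eq_zero fun k hk ↦ by simp_all [coxeterWeightIn]
  have h1 := Finset.sum_filter_add_sum_filter_not Finset.univ (fun k ↦ P.pairingIn ℤ k i < 0)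
    (fun k ↦ P.coxeterWeightIn ℤ k i)
  have h2 := Finset.sum_filter_add_sum_filter_not {k | ¬ P.pairingIn ℤ k i < 0}
    (fun k ↦ P.pairingIn ℤ k i = 0) (fun k ↦ P.coxeterWeightIn ℤ k i)
  rw [Finset.filter_filter, Finset.filter_filter] at h2
  have e1 : ({k | ¬ P.pairingIn ℤ k i < 0 ∧ P.pairingIn ℤ k i = 0} : Finset ι) =
      ({k | P.pairingIn ℤ k i = 0} : Finset ι) := by ext; grind
  have e2 : ({k | ¬ P.pairingIn ℤ k i < 0 ∧ ¬ P.pairingIn ℤ k i = 0} : Finset ι) =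
      ({k | 0 < P.pairingIn ℤ k i} : Finset ι) := by ext; grind
  rw [e1, e2] at h2
  linarith

variable {P} in
lemma negReflection_mem_acute {i k : ι} (hk : k ∈ P.acute i) : P.negReflection i k ∈ P.acute i := by
  refine mem_acute.mpr ⟨by rw [pairingIn_negReflection]; exact (mem_acute.mp hk).1, fun h ↦ ?_⟩
  have := congrArg (P.negReflection i) h
  rw [negReflection_negReflection] at this
  have h' : P.negReflection i i = i := P.root.injective (by simp [root_negReflection, two_smul])
  exact (mem_acute.mp hk).2 (this.trans h')

variable {P} in
lemma negReflection_ne_of_mem_acute [P.IsReduced] {i k : ι} (hk : k ∈ P.acute i) :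
    P.negReflection i k ≠ k := by
  obtain ⟨h, h'⟩ := mem_acute.mp hk
  refine P.negReflection_ne h' fun hneg ↦ ?_
  have := ((P.pairingIn_neg_two_neg_two_iff ℤ k i).mpr hneg).1
  omega

lemma even_sum_acute [P.IsReduced] (i : ι) :
    Even (∑ k ∈ P.acute i, P.coxeterWeightIn ℤ k i) := by
  rw [even_iff_two_dvd]
  refine (ZMod.intCast_zmod_eq_zero_iff_dvd _ 2).mp ?_
  rw [Int.cast_sum]
  refine Finset.sum_involution (fun k _ ↦ P.negReflection i k) ?_ ?_ ?_ ?_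
  · intro k _
    rw [coxeterWeightIn_negReflection, CharTwo.add_self_eq_zero]
  · exact fun k hk _ ↦ negReflection_ne_of_mem_acute hk
  · exact fun k hk ↦ negReflection_mem_acute hk
  · exact fun k _ ↦ P.negReflection_negReflection i k

variable {P} in
lemma coxeterWeightIn_pos_of_mem_acute {i k : ι} (hk : k ∈ P.acute i) :
    0 < P.coxeterWeightIn ℤ k i :=
  mul_pos (mem_acute.mp hk).1 (mem_acute.mp (P.mem_acute_comm.mp hk)).1

variable {P} in
lemma root_mem_span_pair_of_sum_acute_eq_two [P.IsReduced] {i j k : ι}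
    (h : ∑ k ∈ P.acute i, P.coxeterWeightIn ℤ k i = 2) (hj : j ∈ P.acute i)
    (hk : P.pairingIn ℤ k i ≠ 0) :
    P.root k ∈ Submodule.span K {P.root i, P.root j} := by
  classical
  wlog hpos : 0 < P.pairingIn ℤ k i generalizing k
  · have := this (k := P.reflectionPerm k k) (by simpa using hk)
      (by rw [pairingIn_reflectionPerm_self_left]; omega)
    rwa [root_reflectionPerm, reflection_apply_self, Submodule.neg_mem_iff] at this
  have hi : P.root i ∈ Submodule.span K {P.root i, P.root j} := Submodule.subset_span (by simp)
  have hj' : P.root j ∈ Submodule.span K {P.root i, P.root j} := Submodule.subset_span (by simp)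
  by_cases hki : k = i
  · rwa [hki]
  by_cases hkj : k = j
  · rwa [hkj]
  by_cases hkj' : k = P.negReflection i j
  · rw [hkj', root_negReflection]
    exact sub_mem (Submodule.smul_mem _ _ hi) hj'
  have hka : k ∈ P.acute i := mem_acute.mpr ⟨hpos, hki⟩
  have hsub : ({k, P.negReflection i j, j} : Finset ι) ⊆ P.acute i := by
    simp [Finset.insert_subset_iff, hka, hj, negReflection_mem_acute hj]
  have hle := Finset.sum_le_sum_of_subset_of_nonneg (f := fun k ↦ P.coxeterWeightIn ℤ k i) hsub
    fun k hk _ ↦ (coxeterWeightIn_pos_of_mem_acute hk).le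
  rw [Finset.sum_insert (by simp [hkj, hkj']),
    Finset.sum_pair (negReflection_ne_of_mem_acute hj), h] at hle
  have h1 := coxeterWeightIn_pos_of_mem_acute hka
  have h2 := coxeterWeightIn_pos_of_mem_acute hj
  have h3 := coxeterWeightIn_pos_of_mem_acute (negReflection_mem_acute hj)
  omega

lemma finrank_le_two_of_sum_acute_eq_two [P.IsReduced] [P.IsIrreducible] [Nonempty ι]
    (h : ∀ i, ∑ k ∈ P.acute i, P.coxeterWeightIn ℤ k i = 2) : finrank K M ≤ 2 := by
  classical
  obtain ⟨i⟩ := ‹Nonempty ι›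
  obtain ⟨j, hj⟩ : (P.acute i).Nonempty := by
    rw [Finset.nonempty_iff_ne_empty]
    intro h0
    simpa [h0] using h i
  have htop := P.span_root_image_eq_top_of_forall_orthogonal {i, j} ⟨i, by simp⟩ <| by
    have (k l : ι) (hkl : P.pairingIn ℤ k l = 0) : P.IsOrthogonal k l := by
      rw [← coxeterWeight_zero_iff_isOrthogonal, ← P.algebraMap_coxeterWeightIn ℤ,
        (P.coxeterWeightIn_eq_zero_iff k l).mpr hkl, map_zero]
    rintro k hk l (rfl | rfl)
    · refine this _ _ ?_
      contrapose! hk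
      simpa [Set.image_pair] using root_mem_span_pair_of_sum_acute_eq_two (h _) hj hk
    · refine this _ _ ?_
      contrapose! hk
      simpa [Set.image_pair, Set.pair_comm] using
        root_mem_span_pair_of_sum_acute_eq_two (h _) (P.mem_acute_comm.mp hj) hk
  rw [← finrank_top, ← htop, Set.image_pair, ← Finset.coe_pair]
  exact (finrank_span_finset_le_card _).trans Finset.card_le_two

lemma even_card (P : RootPairing ι K M N) : Even (Fintype.card ι) := by
  rw [even_iff_two_dvd, ← ZMod.natCast_eq_zero_iff, ← Finset.card_univ, Finset.cast_card]
  refine Finset.sum_involution (fun k _ ↦ P.reflectionPerm k k) ?_ ?_ ?_ ?_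
  · exact fun _ _ ↦ by decide
  · intro k _ _ hk
    have h := congrArg P.root hk
    rw [root_reflectionPerm, reflection_apply_self] at h
    rw [neg_eq_iff_add_eq_zero, ← two_smul K] at h
    exact P.ne_zero k ((smul_eq_zero_iff_right two_ne_zero).mp h)
  · simp
  · intro k _
    refine P.root.injective ?_
    rw [root_reflectionPerm, reflection_apply_self, root_reflectionPerm, reflection_apply_self,
      neg_neg]

/-- In an irreducible root system of rank `r` the number of roots is `r * h` with `h ≥ 2` and
`h ≠ 3` unless `r ≤ 2`. -/
lemma exists_card_eq_finrank_mul [IsAlgClosed K] [FiniteDimensional K M] [P.IsReduced]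
    [P.IsIrreducible] [Nonempty ι] :
    ∃ h : ℕ, Fintype.card ι = finrank K M * h ∧ 2 ≤ h ∧ (h = 3 → finrank K M ≤ 2) := by
  have key (i : ι) : (8 + 2 * ∑ k ∈ P.acute i, P.coxeterWeightIn ℤ k i) * finrank K M =
      4 * Fintype.card ι := by
    rw [← sum_coxeterWeightIn]
    have := P.sum_coxeterWeight_mul_finrank i
    simp only [← P.algebraMap_coxeterWeightIn ℤ] at this
    rw [← map_sum] at this
    simp only [eq_intCast] at this
    exact_mod_cast this
  have hr : 0 < finrank K M :=
    have := IsIrreducible.nontrivial P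
    finrank_pos
  obtain ⟨i⟩ := ‹Nonempty ι›
  obtain ⟨m, hm⟩ := P.even_sum_acute i
  have hm0 : 0 ≤ m := by
    have := Finset.sum_nonneg fun k hk ↦ (coxeterWeightIn_pos_of_mem_acute (P := P) (i := i) hk).le
    omega
  lift m to ℕ using hm0
  have hcard : Fintype.card ι = finrank K M * (m + 2) := by
    have := key i
    rw [hm] at this
    zify
    linarith
  refine ⟨m + 2, hcard, by omega, fun h3 ↦ P.finrank_le_two_of_sum_acute_eq_two fun j ↦ ?_⟩
  have hj := key j
  rw [hcard, h3] at hj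
  push_cast at hj
  have : (8 + 2 * ∑ k ∈ P.acute j, P.coxeterWeightIn ℤ k j) = 12 :=
    mul_right_cancel₀ (b := (finrank K M : ℤ)) (by positivity) (by linarith)
  omega

end RootPairing

lemma Module.End.isNilpotent_of_forall_trace_aeval_mul_self_eq_zero
    {F V : Type*} [Field F] [CharZero F] [AddCommGroup V] [Module F V] [FiniteDimensional F V]
    {c : End F V} (hc : ∀ q : Polynomial F, LinearMap.trace F V (Polynomial.aeval c q * c) = 0) :
    IsNilpotent c := by
  have hp : minpoly F c ≠ 0 := minpoly.ne_zero (Algebra.IsIntegral.isIntegral c)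
  obtain ⟨r, hr, hXr⟩ := Polynomial.exists_eq_pow_rootMultiplicity_mul_and_not_dvd _ hp 0
  set k := (minpoly F c).rootMultiplicity 0
  simp only [map_zero, sub_zero] at hr hXr
  obtain ⟨u, v, huv⟩ : IsCoprime (Polynomial.X ^ (k + 1)) r :=
    ((Polynomial.irreducible_X.coprime_iff_not_dvd).mpr hXr).pow_left
  have hann : Polynomial.aeval c (Polynomial.X ^ k * r) = 0 := hr ▸ minpoly.aeval F c
  set e := Polynomial.aeval c (u * Polynomial.X ^ (k + 1))
  have hidem : IsIdempotentElem e := by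
    have h : u * Polynomial.X ^ (k + 1) * (u * Polynomial.X ^ (k + 1)) =
        u * Polynomial.X ^ (k + 1) - u * v * Polynomial.X * (Polynomial.X ^ k * r) := by
      linear_combination u * Polynomial.X ^ (k + 1) * huv
    rw [IsIdempotentElem, ← map_mul, h, map_sub, map_mul _ _ (Polynomial.X ^ k * r), hann,
      mul_zero, sub_zero]
  have htr : LinearMap.trace F V e = 0 := by
    have := hc (u * Polynomial.X ^ k)
    rwa [show Polynomial.aeval c (u * Polynomial.X ^ k) * c = e by
      simp [e, pow_succ, mul_assoc]] at this
  have he : e = 0 := LinearMap.IsIdempotentElem.eq_zero_of_trace_eq_zero hidem htr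
  refine ⟨k, ?_⟩
  have h : (Polynomial.X ^ k : Polynomial F) =
      Polynomial.X ^ k * (u * Polynomial.X ^ (k + 1)) + v * (Polynomial.X ^ k * r) := by
    linear_combination -Polynomial.X ^ k * huv
  have := congrArg (Polynomial.aeval c) h
  rw [map_add, map_mul, map_mul _ v, hann, show Polynomial.aeval c _ = 0 from he, mul_zero,
    mul_zero, add_zero] at this
  simpa using this

/-- Jacobson's lemma. -/
lemma Module.End.isNilpotent_of_commute_commutator
    {F V : Type*} [Field F] [CharZero F] [AddCommGroup V] [Module F V] [FiniteDimensional F V]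
    {a b : End F V} (h : Commute a (a * b - b * a)) : IsNilpotent (a * b - b * a) := by
  refine isNilpotent_of_forall_trace_aeval_mul_self_eq_zero fun q ↦ ?_
  have hq : Commute a (Polynomial.aeval (a * b - b * a) q) :=
    Algebra.commute_of_mem_adjoin_singleton_of_commute (Polynomial.aeval_mem_adjoin_singleton F _) h
  rw [mul_sub, ← mul_assoc, ← hq.eq, map_sub, mul_assoc, LinearMap.trace_mul_comm, mul_assoc,
    sub_self]

lemma LieAlgebra.ad_lie_eq_commutator {K L : Type*} [Field K] [LieRing L] [LieAlgebra K L]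
    (x y : L) : ad K L ⁅x, y⁆ = ad K L x * ad K L y - ad K L y * ad K L x := by
  ext z
  simp

lemma LieAlgebra.commute_ad_of_lie_eq_zero {K L : Type*} [Field K] [LieRing L] [LieAlgebra K L]
    {x y : L} (h : ⁅x, y⁆ = 0) : Commute (ad K L x) (ad K L y) := by
  rw [commute_iff_eq, ← sub_eq_zero, ← ad_lie_eq_commutator, h, map_zero]

lemma DirectSum.IsInternal.finrank_eq_sum {ι K V : Type*} [DecidableEq ι] [Fintype ι] [Field K]
    [AddCommGroup V] [Module K V] [FiniteDimensional K V] {N : ι → Submodule K V}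
    (h : DirectSum.IsInternal N) : finrank K V = ∑ i, finrank K (N i) := by
  rw [← finrank_directSum, (LinearEquiv.ofBijective (DirectSum.coeLinearMap N) h).finrank_eq]

namespace IsLieGrading

variable {F A L : Type*} [Field F] [AddCommGroup A] [DecidableEq A] [LieRing L] [LieAlgebra F L]
  {gr : A → Submodule F L}

lemma killingForm_eq_zero [FiniteDimensional F L] (hgr : IsLieGrading F gr) {a b : A}
    (hab : a + b ≠ 0) {x y : L} (hx : x ∈ gr a) (hy : y ∈ gr b) : killingForm F L x y = 0 := by
  rw [killingForm_apply_apply]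
  refine LinearMap.trace_eq_zero_of_mapsTo_ne hgr.1 (fun c ↦ a + (b + c)) (fun c ↦ ?_)
    fun c z hz ↦ ?_
  · simpa [← add_assoc] using hab
  · exact hgr.2 _ _ _ hx _ (hgr.2 _ _ _ hy _ hz)

/-- The homogeneous components `p` of a grading: bracketing with an element of degree `a` shifts
them by `a`. -/
lemma exists_proj (hgr : IsLieGrading F gr) : ∃ p : A → L → L, (∀ c x, p c x ∈ gr c) ∧
    (∀ x, (∀ c, p c x = 0) → x = 0) ∧ (∀ c, p c 0 = 0) ∧
    ∀ a, ∀ h ∈ gr a, ∀ c x, p (a + c) ⁅h, x⁆ = ⁅h, p c x⁆ := by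
  let := hgr.1.chooseDecomposition
  refine ⟨fun c x ↦ DirectSum.decompose gr x c, fun c x ↦ SetLike.coe_mem _, fun x hx ↦ ?_,
    by simp, fun a h hh c x ↦ ?_⟩
  · refine (DirectSum.decompose gr).injective ?_
    ext c
    simpa using hx c
  · dsimp only
    induction x using DirectSum.Decomposition.inductionOn gr with
    | zero => simp
    | @homogeneous d m =>
      by_cases hcd : d = c
      · subst hcd
        rw [DirectSum.decompose_of_mem_same gr (hgr.2 a d h hh m m.2), DirectSum.decompose_coe,
          DirectSum.of_eq_same]
      · rw [DirectSum.decompose_of_mem_ne gr (hgr.2 a d h hh m m.2) (mt add_left_cancel hcd),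
          DirectSum.decompose_of_mem_ne gr m.2 hcd, lie_zero]
    | add m m' hm hm' =>
      simp only [lie_add, DirectSum.decompose_add, DirectSum.add_apply, Submodule.coe_add, hm, hm']

variable [CharZero F] [FiniteDimensional F L] [LieAlgebra.IsKilling F L]

lemma lie_eq_zero_of_mem (hgr : IsLieGrading F gr) (h0 : gr 0 = ⊥) {a b : A} {h x : L}
    (hh : h ∈ gr a) (hx : x ∈ gr b) (hhx : ⁅h, ⁅h, x⁆⁆ = 0) : ⁅h, x⁆ = 0 := by
  have hz : ⁅h, x⁆ ∈ gr (a + b) := hgr.2 a b h hh x hx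
  have hnil : IsNilpotent (LieAlgebra.ad F L ⁅h, x⁆) := by
    rw [LieAlgebra.ad_lie_eq_commutator]
    refine Module.End.isNilpotent_of_commute_commutator ?_
    rw [← LieAlgebra.ad_lie_eq_commutator]
    exact LieAlgebra.commute_ad_of_lie_eq_zero hhx
  refine (LieAlgebra.IsKilling.killingForm_nondegenerate F L).1 _ fun y ↦ ?_
  have hy : y ∈ ⨆ c, gr c := hgr.1.submodule_iSup_eq_top ▸ Submodule.mem_top
  induction hy using Submodule.iSup_induction' with
  | mem c y hy =>
    by_cases hc : a + b + c = 0
    · have hzy : ⁅⁅h, x⁆, y⁆ = 0 := by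
        simpa [hc, h0] using hgr.2 _ _ _ hz _ hy
      have hcomm : Commute (LieAlgebra.ad F L ⁅h, x⁆) (LieAlgebra.ad F L y) :=
        LieAlgebra.commute_ad_of_lie_eq_zero hzy
      rw [killingForm_apply_apply]
      exact (LinearMap.isNilpotent_trace_of_isNilpotent (hcomm.isNilpotent_mul_right hnil)).eq_zero
    · exact hgr.killingForm_eq_zero hc hz hy
  | zero => simp
  | add y y' _ _ hy hy' => rw [map_add, hy, hy', add_zero]

lemma lie_eq_zero_of_lie_lie_eq_zero (hgr : IsLieGrading F gr) (h0 : gr 0 = ⊥) {a : A} {h x : L}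
    (hh : h ∈ gr a) (hhx : ⁅h, ⁅h, x⁆⁆ = 0) : ⁅h, x⁆ = 0 := by
  obtain ⟨p, hp, hp_eq, hp_zero, hp_lie⟩ := hgr.exists_proj
  refine hp_eq _ fun c ↦ ?_
  obtain ⟨c, rfl⟩ : ∃ d, c = a + d := ⟨c - a, by abel⟩
  rw [hp_lie a h hh]
  refine hgr.lie_eq_zero_of_mem h0 hh (hp c x) ?_
  rw [← hp_lie a h hh, ← hp_lie a h hh, hhx, hp_zero]

end IsLieGrading

/-- The centralizer of a subspace of a Lie algebra. -/
def Submodule.lieCentralizer {K L : Type*} [Field K] [LieRing L] [LieAlgebra K L]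
    (S : Submodule K L) : LieSubalgebra K L where
  carrier := {x | ∀ h ∈ S, ⁅h, x⁆ = 0}
  add_mem' hx hy h hh := by rw [lie_add, hx h hh, hy h hh, add_zero]
  zero_mem' h _ := lie_zero h
  smul_mem' c x hx h hh := by rw [lie_smul, hx h hh, smul_zero]
  lie_mem' hx hy h hh := by rw [leibniz_lie, hx h hh, hy h hh, zero_lie, lie_zero, add_zero]

/-- An abelian subspace `S` whose elements `h` satisfy `ker (ad h) ^ 2 = ker (ad h)` is contained
in a Cartan subalgebra. -/
lemma LieAlgebra.exists_isCartanSubalgebra_of_le {K L : Type*} [Field K] [Infinite K] [LieRing L]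
    [LieAlgebra K L] [FiniteDimensional K L] (S : Submodule K L)
    (hS : ∀ x ∈ S, ∀ y ∈ S, ⁅x, y⁆ = 0)
    (hS' : ∀ h ∈ S, ∀ x : L, ⁅h, ⁅h, x⁆⁆ = 0 → ⁅h, x⁆ = 0) :
    ∃ H : LieSubalgebra K L, S ≤ H.toSubmodule ∧ H.IsCartanSubalgebra := by
  obtain ⟨c, hc⟩ := LieAlgebra.exists_isCartanSubalgebra_engel K S.lieCentralizer
  have hnil := hc.nilpotent
  set E := LieSubalgebra.engel K c
  have hmem (x : L) : x ∈ E.map S.lieCentralizer.incl ↔ ∃ hx : x ∈ S.lieCentralizer, ⟨x, hx⟩ ∈ E :=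
    ⟨fun ⟨y, hy, hyx⟩ ↦ hyx ▸ ⟨y.2, hy⟩, fun ⟨hx, h⟩ ↦ ⟨⟨x, hx⟩, h, rfl⟩⟩
  have hSH : S ≤ (E.map S.lieCentralizer.incl).toSubmodule := fun h hh ↦ by
    refine (hmem h).mpr ⟨fun k hk ↦ hS _ hk _ hh,
      (LieSubalgebra.mem_engel_iff K _ _).mpr ⟨1, ?_⟩⟩
    rw [pow_one, LieAlgebra.ad_apply]
    exact Subtype.ext (by rw [LieSubalgebra.coe_bracket, ← lie_skew, c.2 h hh, neg_zero]; rfl)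
  refine ⟨_, hSH, ?_, le_antisymm (fun x hx ↦ ?_) (LieSubalgebra.le_normalizer _)⟩
  · let f : E →ₗ⁅K⁆ E.map S.lieCentralizer.incl :=
      { toFun := fun x ↦ ⟨x.1.1, (hmem _).mpr ⟨x.1.2, x.2⟩⟩
        map_add' := fun _ _ ↦ rfl
        map_smul' := fun _ _ ↦ rfl
        map_lie' := rfl }
    refine Function.Surjective.lieAlgebra_isNilpotent (f := f) fun ⟨x, hx⟩ ↦ ?_
    obtain ⟨h1, h2⟩ := (hmem x).mp hx
    exact ⟨⟨⟨x, h1⟩, h2⟩, rfl⟩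
  · rw [LieSubalgebra.mem_normalizer_iff'] at hx
    have hxC : x ∈ S.lieCentralizer := fun h hh ↦
      hS' h hh x (((hmem _).mp (hx h (hSH hh))).1 h hh)
    refine (hmem x).mpr ⟨hxC, ?_⟩
    rw [← hc.self_normalizing, LieSubalgebra.mem_normalizer_iff']
    exact fun y hy ↦ ((hmem _).mp (hx y ((hmem _).mpr ⟨y.2, hy⟩))).2

open LieAlgebra LieModule in
lemma LieAlgebra.IsKilling.finrank_eq_finrank_add_card_root {K L : Type*} [Field K] [CharZero K]
    [LieRing L] [LieAlgebra K L] [FiniteDimensional K L] [IsKilling K L] (H : LieSubalgebra K L)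
    [H.IsCartanSubalgebra] [Nontrivial H] [IsTriangularizable K H L] :
    finrank K L = finrank K H + Fintype.card H.root := by
  classical
  have hint := DirectSum.isInternal_submodule_of_iSupIndep_of_iSup_eq_top
    (LieSubmodule.iSupIndep_toSubmodule.mpr <| iSupIndep_genWeightSpace' K H L)
    (LieSubmodule.iSup_toSubmodule_eq_top.mpr <| iSup_genWeightSpace_eq_top' K H L)
  rw [hint.finrank_eq_sum, Fintype.card_coe, ← Finset.sum_filter_add_sum_filter_not Finset.univ
    (fun χ : Weight K H L ↦ χ.IsZero)]
  congr 1
  · rw [Finset.sum_congr (s₂ := {0}) (by ext; simp [Weight.isZero_iff_eq_zero]) fun _ _ ↦ rfl,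
      Finset.sum_singleton]
    exact congrArg (fun N : LieSubmodule K H L ↦ finrank K N) (rootSpace_zero_eq K L H)
  · rw [Finset.card_eq_sum_ones]
    refine Finset.sum_congr rfl fun χ hχ ↦ ?_
    exact finrank_rootSpace_eq_one χ (by simpa using hχ)

theorem components_are_cartan_E8
    (F : Type*) [Field F] [IsAlgClosed F] [CharZero F]
    (L : Type*) [LieRing L] [LieAlgebra F L] [FiniteDimensional F L]
    [LieAlgebra.IsSimple F L] (hdim : finrank F L = 248)
    (gr : (Fin 5 → ZMod 2) → Submodule F L) (hgr : IsLieGrading F gr)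
    (hdims : ∀ a : Fin 5 → ZMod 2, a ≠ 0 → finrank F (gr a) = 8) :
    ∀ α : Fin 5 → ZMod 2, α ≠ 0 →
      ∃ H : LieSubalgebra F L, H.toSubmodule = gr α ∧ H.IsCartanSubalgebra := by
  intro α hα
  have h0 : gr 0 = ⊥ := by
    have h := hgr.1.finrank_eq_sum
    rw [← Finset.add_sum_erase _ _ (Finset.mem_univ 0), Finset.sum_congr rfl
      fun a ha ↦ hdims a (Finset.ne_of_mem_erase ha), Finset.sum_const, hdim,
      Finset.card_erase_of_mem (Finset.mem_univ 0)] at h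
    simpa using h
  obtain ⟨H, hle, hH⟩ := LieAlgebra.exists_isCartanSubalgebra_of_le (gr α)
    (fun x hx y hy ↦ by simpa [CharTwo.add_self_eq_zero, h0] using hgr.2 α α x hx y hy)
    (fun h hh x ↦ hgr.lie_eq_zero_of_lie_lie_eq_zero h0 hh)
  refine ⟨H, (Submodule.eq_of_le_of_finrank_eq hle ?_).symm, hH⟩
  have hle' := Submodule.finrank_mono hle
  rw [hdims α hα] at hle' ⊢
  have : Nontrivial H := Module.nontrivial_of_finrank_pos (R := F) (by
    have : finrank F H = finrank F H.toSubmodule := rfl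
    omega)
  have hcard := LieAlgebra.IsKilling.finrank_eq_finrank_add_card_root H
  let P := LieAlgebra.IsKilling.rootSystem H
  have : Nonempty H.root := by
    by_contra hempty
    rw [not_nonempty_iff] at hempty
    have := RootPairing.IsRootSystem.span_root_eq_top (P := P)
    simp [Set.range_eq_empty] at this
  obtain ⟨m, hm⟩ := P.even_card
  obtain ⟨h, hh, h2, h3⟩ := P.exists_card_eq_finrank_mul
  rw [Subspace.dual_finrank_eq] at hh h3
  change 8 ≤ finrank F H at hle'
  change 8 = finrank F H
  generalize finrank F H = r at *
  have hr : r * (1 + h) = 248 := by rw [mul_add, ← hh]; omega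
  have hr' : r ≤ 82 := by nlinarith
  interval_cases r <;> omega
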